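/- Let T be an affine algebraic theory and let f, g ∈ T(n). If the coefficients f[i] = g[i] for all 1 ≤ i ≤ n, then f = g. -/

import Mathlib

/-!
An algebraic theory (abstract clone): a family of sets `T n`,
projections `π n i` and composition `comp`, subject to the unit
and associativity laws.
-/
universe u

structure Clone where
  T : ℕ → Type u
  π : (n : ℕ) → Fin n → T n
  comp : {n m : ℕ} → T n → (Fin n → T m) → T m
  comp_proj : ∀ {n m : ℕ} (i : Fin n) (g : Fin n → T m), comp (π n i) g = g i
  proj_comp : ∀ {n : ℕ} (f : T n), comp f (π n) = f
  assoc : ∀ {n m k : ℕ} (f : T n) (g : Fin n → T m) (h : Fin m → T k),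
      comp (comp f g) h = comp f (fun i => comp (g i) h)

namespace Clone

variable (C : Clone)

/-- `f` is idempotent: `f ∘ (g,…,g) = g`. -/
def Idem {n : ℕ} (f : C.T n) : Prop :=
  ∀ (m : ℕ) (g : C.T m), C.comp f (fun _ => g) = g

/-- `f` splits: `f(f(x¹₁,…,x¹ₙ),…,f(xⁿ₁,…,xⁿₙ)) = f(x¹₁,x²₂,…,xⁿₙ)` as an identity. -/
def Splits {n : ℕ} (f : C.T n) : Prop :=
  ∀ (m : ℕ) (x : Fin n → Fin n → C.T m),
    C.comp f (fun i => C.comp f (x i)) = C.comp f (fun i => x i i)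

/-- `f` and `g` commute. -/
def Commutes {n m : ℕ} (f : C.T n) (g : C.T m) : Prop :=
  ∀ (k : ℕ) (x : Fin n → Fin m → C.T k),
    C.comp f (fun i => C.comp g (x i)) = C.comp g (fun j => C.comp f (fun i => x i j))

/-- A theory is hyperaffine if every operation is idempotent, every pair of
operations commutes, and every operation splits. -/
def Hyperaffine : Prop :=
  (∀ (n : ℕ) (f : C.T n), C.Idem f) ∧
  (∀ (n m : ℕ) (f : C.T n) (g : C.T m), C.Commutes f g) ∧
  (∀ (n : ℕ) (f : C.T n), C.Splits f)

/-- The `i`-th coefficient `f[i] := f ∘ (π²₂,…,π²₁,…,π²₂)` with `π²₁` in position `i`. -/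
def coeff {n : ℕ} (f : C.T n) (i : Fin n) : C.T 2 :=
  C.comp f (fun j => if j = i then C.π 2 0 else C.π 2 1)

/-- `a ∧ b := a ∘ (b, π²₂)` on `T 2`. -/
def band (a b : C.T 2) : C.T 2 := C.comp a ![b, C.π 2 1]

/-- `a ∨ b := a ∘ (π²₁, b)` on `T 2`. -/
def bor (a b : C.T 2) : C.T 2 := C.comp a ![C.π 2 0, b]

/-- `¬a := a ∘ (π²₂, π²₁)` on `T 2`. -/
def bnot (a : C.T 2) : C.T 2 := C.comp a ![C.π 2 1, C.π 2 0]

/-- `p ∈ T 3` is a Mal'cev operation: `p(x,y,y) = x` and `p(x,x,y) = y`. -/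
def Malcev (p : C.T 3) : Prop :=
  ∀ (m : ℕ) (x y : C.T m), C.comp p ![x, y, y] = x ∧ C.comp p ![x, x, y] = y

/-- `a + b := p ∘ (a, π²₂, b)` on `T 2`. -/
def padd (p : C.T 3) (a b : C.T 2) : C.T 2 := C.comp p ![a, C.π 2 1, b]

/-- `-a := p ∘ (π²₂, a, π²₂)` on `T 2`. -/
def pneg (p : C.T 3) (a : C.T 2) : C.T 2 := C.comp p ![C.π 2 1, a, C.π 2 1]

end Clone

/-- Right-nested fold: `rfold op a [b, c] = op a (op b c)`. -/
def rfold {α : Type*} (op : α → α → α) : α → List α → α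
  | a, [] => a
  | a, b :: l => op a (rfold op b l)

/-- Left-nested fold: `lfold op a [b, c] = op (op a b) c`. -/
def lfold {α : Type*} (op : α → α → α) (a : α) (l : List α) : α := l.foldl op a

namespace Clone

/-- Evaluating `f` at `a` in position `i` and `b` elsewhere amounts to evaluating `f[i]` at
`(a, b)`. -/
theorem coeff_comp (C : Clone) {n m : ℕ} (f : C.T n) (i : Fin n) (a b : C.T m) :
    C.comp (C.coeff f i) ![a, b] = C.comp f (fun j => if j = i then a else b) := by
  rw [coeff, C.assoc]
  congr 1
  funext j
  split_ifs <;> simp [C.comp_proj]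

/-- Commutation with `p` computes `f` at a pointwise `p`-combination of three tuples. -/
theorem comp_malcev_comp (C : Clone) {n m : ℕ} {f : C.T n} {p : C.T 3} (hfp : C.Commutes f p)
    (a b c : Fin n → C.T m) :
    C.comp f (fun i => C.comp p ![a i, b i, c i]) =
      C.comp p ![C.comp f a, C.comp f b, C.comp f c] := by
  rw [hfp m (fun i => ![a i, b i, c i])]
  congr 1
  funext j
  fin_cases j <;> rfl

/-- Adding a position `i` to the set where `x` replaces the base point `o` changes the value of
`f` by its coefficient `f[i]`. -/
theorem comp_piecewise_insert (C : Clone) {n m : ℕ} {f : C.T n} {p : C.T 3} (hf : C.Idem f)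
    (hfp : C.Commutes f p) (hp : C.Malcev p) (x : Fin n → C.T m) (o : C.T m)
    {s : Finset (Fin n)} {i : Fin n} (hi : i ∉ s) :
    C.comp f (fun j => if j ∈ insert i s then x j else o) =
      C.comp p ![C.comp f (fun j => if j ∈ s then x j else o), o,
        C.comp (C.coeff f i) ![x i, o]] := by
  have key := C.comp_malcev_comp hfp (fun j => if j ∈ s then x j else o) (fun _ => o)
    (fun j => if j = i then x i else o)
  rw [hf m o] at key
  rw [C.coeff_comp, ← key]
  congr 1
  funext j
  by_cases hj : j = i
  · subst hj
    simp [hi, (hp m o (x j)).2]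
  · by_cases hs : j ∈ s <;> simp [hj, hs, (hp m _ o).1]

end Clone

/-- In an affine theory, an operation is determined by its coefficients. -/
theorem coeff_injective_of_affine (C : Clone)
    (hidem : ∀ (n : ℕ) (f : C.T n), C.Idem f)
    (hcomm : ∀ (n m : ℕ) (f : C.T n) (g : C.T m), C.Commutes f g)
    (p : C.T 3) (hp : C.Malcev p)
    (n : ℕ) (f g : C.T n) (h : ∀ i : Fin n, C.coeff f i = C.coeff g i) : f = g := by
  rcases n with _ | n
  · have hπ : C.π 0 = fun _ => g := funext fun i => i.elim0
    rw [← hidem 0 f 0 g, ← hπ, C.proj_comp]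
  · have key (s : Finset (Fin (n + 1))) :
        C.comp f (fun j => if j ∈ s then C.π (n + 1) j else C.π (n + 1) 0) =
          C.comp g (fun j => if j ∈ s then C.π (n + 1) j else C.π (n + 1) 0) := by
      induction s using Finset.induction_on with
      | empty => simp only [Finset.notMem_empty, if_false, hidem _ f _ _, hidem _ g _ _]
      | insert i s hi ih =>
        rw [C.comp_piecewise_insert (hidem _ f) (hcomm _ _ f p) hp _ _ hi,
          C.comp_piecewise_insert (hidem _ g) (hcomm _ _ g p) hp _ _ hi, ih, h i]
    simpa [C.proj_comp] using key Finset.univ
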